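/- arXiv:2407.07033 — 10 statements merged into one kernel-verified Lean document; each statement's English description precedes it below -/
import Mathlib

section
/- For all real numbers d_A ≥ 0 and d_B ≥ 0 there exist nonempty compact sets A and B in ℝ² such that d(A) = d_A, d(B) = d_B, and d(A+B)² = d_A² + d_B². (Hence the bound d(A+B)² ≤ d(A)² + d(B)² is optimal.) -/
open Pointwise

/-- Hausdorff distance from a set to its convex hull. -/
noncomputable def hdist {n : ℕ} (A : Set (EuclideanSpace ℝ (Fin n))) : ℝ :=
  Metric.hausdorffDist (convexHull ℝ A) A

/-- The vertices of the rectangle `[-a, a] × [-b, b]`. -/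
def rectVertices (a b : ℝ) : Set (EuclideanSpace ℝ (Fin 2)) :=
  {x | |x 0| = a ∧ |x 1| = b}

theorem mem_rectVertices {a b : ℝ} {x : EuclideanSpace ℝ (Fin 2)} :
    x ∈ rectVertices a b ↔ |x 0| = a ∧ |x 1| = b :=
  Iff.rfl

theorem rectVertices_nonempty {a b : ℝ} (ha : 0 ≤ a) (hb : 0 ≤ b) :
    (rectVertices a b).Nonempty :=
  ⟨!₂[a, b], by simp [mem_rectVertices, abs_of_nonneg, ha, hb]⟩

theorem isCompact_rectVertices (a b : ℝ) : IsCompact (rectVertices a b) := by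
  refine Metric.isCompact_of_isClosed_isBounded ?_ ?_
  · exact (isClosed_eq (by fun_prop) continuous_const).inter
      (isClosed_eq (by fun_prop) continuous_const)
  · refine isBounded_iff_forall_norm_le.2 ⟨√(a ^ 2 + b ^ 2), fun x hx => ?_⟩
    rw [EuclideanSpace.norm_eq, Fin.sum_univ_two, Real.norm_eq_abs, Real.norm_eq_abs,
      hx.1, hx.2]

theorem convexHull_rectVertices_subset (a b : ℝ) :
    convexHull ℝ (rectVertices a b) ⊆ {x | |x 0| ≤ a ∧ |x 1| ≤ b} := by
  refine convexHull_min (fun x hx => ⟨hx.1.le, hx.2.le⟩) ?_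
  have hconv (i : Fin 2) (c : ℝ) : Convex ℝ {x : EuclideanSpace ℝ (Fin 2) | |x i| ≤ c} := by
    have h : {x : EuclideanSpace ℝ (Fin 2) | |x i| ≤ c} =
        (EuclideanSpace.proj (𝕜 := ℝ) i).toLinearMap ⁻¹' Set.Icc (-c) c := by
      ext x
      simp [abs_le]
    rw [h]
    exact (convex_Icc (-c) c).linear_preimage _
  exact (hconv 0 a).inter (hconv 1 b)

theorem zero_mem_convexHull_rectVertices {a b : ℝ} (ha : 0 ≤ a) (hb : 0 ≤ b) :
    (0 : EuclideanSpace ℝ (Fin 2)) ∈ convexHull ℝ (rectVertices a b) := by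
  obtain ⟨x, hx⟩ := rectVertices_nonempty ha hb
  have hx' : -x ∈ rectVertices a b := by simpa [mem_rectVertices] using hx
  have h := convex_convexHull ℝ (rectVertices a b) (subset_convexHull ℝ _ hx)
    (subset_convexHull ℝ _ hx') (a := 1 / 2) (b := 1 / 2) (by norm_num) (by norm_num)
    (by norm_num)
  simpa using h

theorem exists_abs_eq_abs_sub_le {a t : ℝ} (ht : |t| ≤ a) :
    ∃ s : ℝ, |s| = a ∧ |t - s| ≤ a := by
  have ha : 0 ≤ a := (abs_nonneg t).trans ht
  rw [abs_le] at ht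
  rcases le_total 0 t with h | h
  · exact ⟨a, abs_of_nonneg ha, abs_le.2 ⟨by linarith, by linarith⟩⟩
  · exact ⟨-a, by rw [abs_neg, abs_of_nonneg ha], abs_le.2 ⟨by linarith, by linarith⟩⟩

theorem hdist_rectVertices {a b : ℝ} (ha : 0 ≤ a) (hb : 0 ≤ b) :
    hdist (rectVertices a b) = √(a ^ 2 + b ^ 2) := by
  have hne := rectVertices_nonempty ha hb
  have hcpt := isCompact_rectVertices a b
  refine le_antisymm ?_ ?_
  · refine Metric.hausdorffDist_le_of_mem_dist (Real.sqrt_nonneg _) (fun x hx => ?_)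
      (fun x hx => ⟨x, subset_convexHull ℝ _ hx, by simp⟩)
    obtain ⟨h0, h1⟩ := convexHull_rectVertices_subset a b hx
    obtain ⟨s, hs, hs'⟩ := exists_abs_eq_abs_sub_le h0
    obtain ⟨t, ht, ht'⟩ := exists_abs_eq_abs_sub_le h1
    refine ⟨!₂[s, t], by simp [mem_rectVertices, hs, ht], ?_⟩
    rw [EuclideanSpace.dist_eq, Fin.sum_univ_two]
    simp only [Real.dist_eq]
    gcongr
    · simpa using hs'
    · simpa using ht'
  · have hfin : Metric.hausdorffEDist (convexHull ℝ (rectVertices a b)) (rectVertices a b) ≠ ⊤ :=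
      Metric.hausdorffEDist_ne_top_of_nonempty_of_bounded hne.convexHull hne
        (isBounded_convexHull.2 hcpt.isBounded) hcpt.isBounded
    refine le_trans ?_ (Metric.infDist_le_hausdorffDist_of_mem
      (zero_mem_convexHull_rectVertices ha hb) hfin)
    refine (Metric.le_infDist hne).2 fun y hy => ?_
    rw [dist_zero_left, EuclideanSpace.norm_eq, Fin.sum_univ_two, Real.norm_eq_abs,
      Real.norm_eq_abs, hy.1, hy.2]

theorem rectVertices_add_rectVertices (a b : ℝ) :
    rectVertices a 0 + rectVertices 0 b = rectVertices a b := by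
  ext z
  rw [Set.mem_add]
  constructor
  · rintro ⟨x, ⟨hx0, hx1⟩, y, ⟨hy0, hy1⟩, rfl⟩
    rw [abs_eq_zero] at hx1 hy0
    simp [mem_rectVertices, hx0, hx1, hy0, hy1]
  · rintro ⟨h0, h1⟩
    refine ⟨!₂[z 0, 0], by simp [mem_rectVertices, h0], !₂[0, z 1],
      by simp [mem_rectVertices, h1], ?_⟩
    ext i
    fin_cases i <;> simp

theorem dyn_farkhi_two_dim_optimal (dA dB : ℝ) (hdA : 0 ≤ dA) (hdB : 0 ≤ dB) :
    ∃ A B : Set (EuclideanSpace ℝ (Fin 2)),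
      A.Nonempty ∧ B.Nonempty ∧ IsCompact A ∧ IsCompact B ∧
      hdist A = dA ∧ hdist B = dB ∧ hdist (A + B) ^ 2 = dA ^ 2 + dB ^ 2 := by
  refine ⟨rectVertices dA 0, rectVertices 0 dB, rectVertices_nonempty hdA le_rfl,
    rectVertices_nonempty le_rfl hdB, isCompact_rectVertices _ _, isCompact_rectVertices _ _,
    ?_, ?_, ?_⟩
  · simp [hdist_rectVertices hdA le_rfl, Real.sqrt_sq hdA]
  · simp [hdist_rectVertices le_rfl hdB, Real.sqrt_sq hdB]
  · rw [rectVertices_add_rectVertices, hdist_rectVertices hdA hdB, Real.sq_sqrt (by positivity)]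
end

section
/- Let v₁, v₂, v₃ ∈ ℝ² be affinely independent points forming an acute triangle T, i.e., each of the three interior angles ∠v₂v₁v₃ = α, ∠v₁v₂v₃ = β, ∠v₁v₃v₂ = γ is strictly less than π/2. Let a = |v₂ − v₃|, b = |v₁ − v₃|, c = |v₁ − v₂| be the side lengths opposite to v₁, v₂, v₃ respectively. Then d({v₁, v₂, v₃}) = a/(2 sin α) = b/(2 sin β) = c/(2 sin γ). -/
open EuclideanGeometry

section NormedSpace

variable {E : Type*} [NormedAddCommGroup E] [NormedSpace ℝ E]

/-- A point of the triangle `o p q` is within `R` of `p` if its weight at `p` is at least its weight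
at `q` and both `p` and `q` are within `R` of `o`. -/
lemma dist_left_le_of_weight_le {o p q x : E} {R a b c : ℝ} (ha : 0 ≤ a) (hc : 0 ≤ c) (hcb : c ≤ b)
    (habc : a + b + c = 1) (hx : x = a • o + b • p + c • q)
    (hp : dist o p ≤ R) (hq : dist o q ≤ R) : dist x p ≤ R := by
  have hR : 0 ≤ R := dist_nonneg.trans hp
  have hxp : x - p = (a + c) • (o - p) + c • (q - o) := by
    obtain rfl : b = 1 - a - c := by linarith
    rw [hx]
    module
  rw [dist_comm, dist_eq_norm] at hq
  rw [dist_eq_norm] at hp ⊢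
  calc ‖x - p‖ ≤ (a + c) * ‖o - p‖ + c * ‖q - o‖ := by
        rw [hxp]
        refine (norm_add_le _ _).trans_eq ?_
        rw [norm_smul, norm_smul, Real.norm_of_nonneg (by positivity), Real.norm_of_nonneg hc]
    _ ≤ (a + c) * R + c * R := by gcongr
    _ = (a + 2 * c) * R := by ring
    _ ≤ 1 * R := by gcongr; linarith
    _ = R := one_mul R

/-- A point of the triangle `o p q` is within `R` of `p` or `q` if both are within `R` of `o`. -/
lemma dist_left_le_or_dist_right_le {o p q x : E} {R a b c : ℝ} (ha : 0 ≤ a) (hb : 0 ≤ b)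
    (hc : 0 ≤ c) (habc : a + b + c = 1) (hx : x = a • o + b • p + c • q)
    (hp : dist o p ≤ R) (hq : dist o q ≤ R) : dist x p ≤ R ∨ dist x q ≤ R := by
  rcases le_total c b with h | h
  · exact Or.inl (dist_left_le_of_weight_le ha hc h habc hx hp hq)
  · exact Or.inr (dist_left_le_of_weight_le ha hb h (by linarith) (by rw [hx]; abel) hq hp)

/-- A point `x` of a triangle `p q s` with interior point `o` lies in the subtriangle `o p q` if its
weight at `s`, relative to that of `o`, is the smallest. -/
lemma dist_le_or_dist_le_of_weights {o p q s x : E} {R l₁ l₂ l₃ m₁ m₂ m₃ : ℝ}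
    (hl₃ : 0 ≤ l₃) (hl : l₁ + l₂ + l₃ = 1) (hx : x = l₁ • p + l₂ • q + l₃ • s)
    (hm₃ : 0 < m₃) (hm : m₁ + m₂ + m₃ = 1) (ho : o = m₁ • p + m₂ • q + m₃ • s)
    (h₁ : l₃ / m₃ * m₁ ≤ l₁) (h₂ : l₃ / m₃ * m₂ ≤ l₂)
    (hp : dist o p ≤ R) (hq : dist o q ≤ R) : dist x p ≤ R ∨ dist x q ≤ R := by
  have h₃ : l₃ = l₃ / m₃ * m₃ := by field_simp
  refine dist_left_le_or_dist_right_le (a := l₃ / m₃) (b := l₁ - l₃ / m₃ * m₁)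
    (c := l₂ - l₃ / m₃ * m₂) (by positivity) (by linarith) (by linarith) ?_ ?_ hp hq
  · linear_combination hl - l₃ / m₃ * hm - h₃
  · rw [ho, hx]
    nth_rewrite 1 [h₃]
    module

lemma exists_weights_of_mem_convexHull_triple {p q s x : E} (hx : x ∈ convexHull ℝ {p, q, s}) :
    ∃ l₁ l₂ l₃ : ℝ, 0 ≤ l₁ ∧ 0 ≤ l₂ ∧ 0 ≤ l₃ ∧ l₁ + l₂ + l₃ = 1 ∧
      x = l₁ • p + l₂ • q + l₃ • s := by
  rw [convexHull_insert (by simp), convexHull_pair, convexJoin_singleton_left] at hx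
  simp only [Set.mem_iUnion, exists_prop] at hx
  obtain ⟨y, ⟨a, b, ha, hb, hab, rfl⟩, ⟨c, d, hc, hd, hcd, rfl⟩⟩ := hx
  refine ⟨c, d * a, d * b, hc, by positivity, by positivity, ?_, ?_⟩
  · linear_combination hcd + d * hab
  · module

/-- If a point in the interior of a triangle is at distance `R` from all three vertices, then `R` is
the Hausdorff distance from the triangle to its set of vertices. -/
lemma hausdorffDist_convexHull_triple_of_dist_eq {o p q s : E} {R m₁ m₂ m₃ : ℝ}
    (hm₁ : 0 < m₁) (hm₂ : 0 < m₂) (hm₃ : 0 < m₃) (hm : m₁ + m₂ + m₃ = 1)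
    (ho : o = m₁ • p + m₂ • q + m₃ • s)
    (hp : dist o p = R) (hq : dist o q = R) (hs : dist o s = R) :
    Metric.hausdorffDist (convexHull ℝ {p, q, s}) {p, q, s} = R := by
  have hsub : ({p, q, s} : Set E) ⊆ convexHull ℝ {p, q, s} := subset_convexHull ℝ _
  have hne : ({p, q, s} : Set E).Nonempty := Set.insert_nonempty _ _
  have hbdd : Bornology.IsBounded ({p, q, s} : Set E) := (Set.toFinite _).isBounded
  have hR : 0 ≤ R := hp ▸ dist_nonneg
  refine le_antisymm (Metric.hausdorffDist_le_of_mem_dist hR ?_ ?_) ?_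
  · intro x hx
    obtain ⟨l₁, l₂, l₃, hl₁, hl₂, hl₃, hl, hx⟩ := exists_weights_of_mem_convexHull_triple hx
    suffices h : dist x p ≤ R ∨ dist x q ≤ R ∨ dist x s ≤ R by
      simpa using h
    have h₁ (hmin : l₁ / m₁ ≤ l₂ / m₂ ∧ l₁ / m₁ ≤ l₃ / m₃) : dist x q ≤ R ∨ dist x s ≤ R :=
      dist_le_or_dist_le_of_weights hl₁ (l₁ := l₂) (l₂ := l₃) (by linarith)
        (by rw [hx]; abel) hm₁ (m₁ := m₂) (m₂ := m₃) (by linarith) (by rw [ho]; abel)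
        ((le_div_iff₀ hm₂).1 hmin.1) ((le_div_iff₀ hm₃).1 hmin.2) hq.le hs.le
    have h₂ (hmin : l₂ / m₂ ≤ l₁ / m₁ ∧ l₂ / m₂ ≤ l₃ / m₃) : dist x p ≤ R ∨ dist x s ≤ R :=
      dist_le_or_dist_le_of_weights hl₂ (l₁ := l₁) (l₂ := l₃) (by linarith)
        (by rw [hx]; abel) hm₂ (m₁ := m₁) (m₂ := m₃) (by linarith) (by rw [ho]; abel)
        ((le_div_iff₀ hm₁).1 hmin.1) ((le_div_iff₀ hm₃).1 hmin.2) hp.le hs.le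
    have h₃ (hmin : l₃ / m₃ ≤ l₁ / m₁ ∧ l₃ / m₃ ≤ l₂ / m₂) : dist x p ≤ R ∨ dist x q ≤ R :=
      dist_le_or_dist_le_of_weights hl₃ hl hx hm₃ hm ho
        ((le_div_iff₀ hm₁).1 hmin.1) ((le_div_iff₀ hm₂).1 hmin.2) hp.le hq.le
    grind
  · exact fun x hx => ⟨x, hsub hx, by simpa using hR⟩
  · have hmem : o ∈ convexHull ℝ {p, q, s} := by
      have hc := convex_convexHull ℝ ({p, q, s} : Set E)
      have hp' : p ∈ convexHull ℝ {p, q, s} := hsub (by simp)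
      have hq' : q ∈ convexHull ℝ {p, q, s} := hsub (by simp)
      have hs' : s ∈ convexHull ℝ {p, q, s} := hsub (by simp)
      have := hc.sum_mem (t := Finset.univ) (w := ![m₁, m₂, m₃]) (z := ![p, q, s])
        (by simp [Fin.forall_fin_succ, hm₁.le, hm₂.le, hm₃.le])
        (by simpa [Fin.sum_univ_three] using hm)
        (by simp [Fin.forall_fin_succ, hp', hq', hs'])
      simpa [Fin.sum_univ_three, ← ho] using this
    refine le_trans ?_ (Metric.infDist_le_hausdorffDist_of_mem hmem
      (Metric.hausdorffEDist_ne_top_of_nonempty_of_bounded (hne.mono hsub) hne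
        (isBounded_convexHull.2 hbdd) hbdd))
    refine (Metric.le_infDist hne).2 ?_
    simp [hp, hq, hs]

end NormedSpace

section InnerProductSpace

variable {V : Type*} [NormedAddCommGroup V] [InnerProductSpace ℝ V]

lemma inner_sub_sub_pos_of_angle_lt_pi_div_two {p q s : V} (h : ∠ p q s < Real.pi / 2) :
    0 < inner ℝ (p - q) (s - q) := by
  have hcos : 0 < Real.cos (InnerProductGeometry.angle (p - q) (s - q)) :=
    Real.cos_pos_of_mem_Ioo
      ⟨by linarith [Real.pi_pos, InnerProductGeometry.angle_nonneg (p - q) (s - q)], h⟩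
  by_contra! hle
  rw [InnerProductGeometry.cos_angle] at hcos
  exact hcos.not_ge (div_nonpos_of_nonpos_of_nonneg hle (by positivity))

/-- An acute triangle contains an interior point equidistant from its vertices. -/
lemma exists_pos_weights_dist_eq_of_acute {p q s : V}
    (hind : AffineIndependent ℝ ![p, q, s]) (hp : ∠ q p s < Real.pi / 2)
    (hq : ∠ p q s < Real.pi / 2) (hs : ∠ p s q < Real.pi / 2) :
    ∃ m₁ m₂ m₃ : ℝ, 0 < m₁ ∧ 0 < m₂ ∧ 0 < m₃ ∧ m₁ + m₂ + m₃ = 1 ∧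
      dist (m₁ • p + m₂ • q + m₃ • s) q = dist (m₁ • p + m₂ • q + m₃ • s) p ∧
      dist (m₁ • p + m₂ • q + m₃ • s) s = dist (m₁ • p + m₂ • q + m₃ • s) p := by
  have hpq : q - p ≠ 0 := sub_ne_zero.2 (hind.injective.ne (show (1 : Fin 3) ≠ 0 by decide))
  have hps : s - p ≠ 0 := sub_ne_zero.2 (hind.injective.ne (show (2 : Fin 3) ≠ 0 by decide))
  have hgram : inner ℝ (q - p) (s - p) ^ 2 < ‖q - p‖ ^ 2 * ‖s - p‖ ^ 2 := by
    have hsin : 0 < Real.sin (∠ q p s) := by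
      refine sin_pos_of_not_collinear ?_
      rw [Set.insert_comm]
      exact affineIndependent_iff_not_collinear_set.1 hind
    have hsqrt := InnerProductGeometry.sin_angle_mul_norm_mul_norm (q - p) (s - p)
    have hpos := Real.sqrt_pos.1 (hsqrt ▸ mul_pos hsin (by positivity))
    rw [real_inner_self_eq_norm_sq, real_inner_self_eq_norm_sq] at hpos
    linarith
  have h₁ := inner_sub_sub_pos_of_angle_lt_pi_div_two hp
  have h₂ := inner_sub_sub_pos_of_angle_lt_pi_div_two hq
  have h₃ := inner_sub_sub_pos_of_angle_lt_pi_div_two hs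
  obtain ⟨u, rfl⟩ : ∃ u, q = p + u := ⟨q - p, by abel⟩
  obtain ⟨w, rfl⟩ : ∃ w, s = p + w := ⟨s - p, by abel⟩
  rw [show p - (p + u) = -u by abel, show p + w - (p + u) = w - u by abel, inner_neg_left,
    inner_sub_right, real_inner_self_eq_norm_sq] at h₂
  rw [show p - (p + w) = -w by abel, show p + u - (p + w) = u - w by abel, inner_neg_left,
    inner_sub_right, real_inner_self_eq_norm_sq, real_inner_comm] at h₃
  simp only [add_sub_cancel_left] at hgram h₁ hpq hps
  have hU : 0 < ‖u‖ ^ 2 := by positivity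
  have hW : 0 < ‖w‖ ^ 2 := by positivity
  have hD : 0 < ‖u‖ ^ 2 * ‖w‖ ^ 2 - inner ℝ u w ^ 2 := by linarith
  set U := ‖u‖ ^ 2 with hUdef
  set W := ‖w‖ ^ 2 with hWdef
  set c := inner ℝ u w with hcdef
  set D := U * W - c ^ 2 with hDdef
  obtain ⟨a, ha⟩ : ∃ a, a = W * (U - c) / (2 * D) := ⟨_, rfl⟩
  obtain ⟨b, hb⟩ : ∃ b, b = U * (W - c) / (2 * D) := ⟨_, rfl⟩
  have hab : 1 - a - b = c * ((U - c) + (W - c)) / (2 * D) := by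
    rw [ha, hb]
    field_simp
    rw [hDdef]
    ring
  have hU' : 0 < U - c := by linarith
  have hW' : 0 < W - c := by linarith
  have hau : 2 * (a * U + b * c) = U := by
    rw [ha, hb]; field_simp; rw [hDdef]; ring
  have haw : 2 * (a * c + b * W) = W := by
    rw [ha, hb]; field_simp; rw [hDdef]; ring
  have ho : (1 - a - b) • p + a • (p + u) + b • (p + w) = p + (a • u + b • w) := by module
  refine ⟨1 - a - b, a, b, hab ▸ by positivity, ha ▸ by positivity, hb ▸ by positivity, by ring,
    ?_, ?_⟩
  all_goals
    rw [ho, dist_eq_norm, dist_eq_norm, add_sub_add_left_eq_sub, add_sub_cancel_left,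
      ← sq_eq_sq₀ (norm_nonneg _) (norm_nonneg _), norm_sub_sq_real]
    simp only [inner_add_left, real_inner_smul_left, real_inner_self_eq_norm_sq,
      real_inner_comm u w, ← hUdef, ← hWdef, ← hcdef]
    linarith

end InnerProductSpace

theorem hausdorff_distance_acute_triangle (v₁ v₂ v₃ : EuclideanSpace ℝ (Fin 2))
    (hind : AffineIndependent ℝ ![v₁, v₂, v₃])
    (hα : EuclideanGeometry.angle v₂ v₁ v₃ < Real.pi / 2)
    (hβ : EuclideanGeometry.angle v₁ v₂ v₃ < Real.pi / 2)
    (hγ : EuclideanGeometry.angle v₁ v₃ v₂ < Real.pi / 2) :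
    hdist {v₁, v₂, v₃} = dist v₂ v₃ / (2 * Real.sin (EuclideanGeometry.angle v₂ v₁ v₃)) ∧
    hdist {v₁, v₂, v₃} = dist v₁ v₃ / (2 * Real.sin (EuclideanGeometry.angle v₁ v₂ v₃)) ∧
    hdist {v₁, v₂, v₃} = dist v₁ v₂ / (2 * Real.sin (EuclideanGeometry.angle v₁ v₃ v₂)) := by
  obtain ⟨m₁, m₂, m₃, hm₁, hm₂, hm₃, hm, h₂, h₃⟩ :=
    exists_pos_weights_dist_eq_of_acute hind hα hβ hγ
  let t : Affine.Triangle ℝ (EuclideanSpace ℝ (Fin 2)) := ⟨![v₁, v₂, v₃], hind⟩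
  have hspan : affineSpan ℝ (Set.range t.points) = ⊤ :=
    hind.affineSpan_eq_top_iff_card_eq_finrank_add_one.2 (by simp)
  have hrad : hdist {v₁, v₂, v₃} = t.circumradius :=
    (hausdorffDist_convexHull_triple_of_dist_eq hm₁ hm₂ hm₃ hm rfl rfl h₂ h₃).trans
      (t.eq_circumradius_of_dist_eq (p := m₁ • v₁ + m₂ • v₂ + m₃ • v₃) (by simp [hspan]) (by
        intro i
        rw [dist_comm]
        fin_cases i
        exacts [rfl, h₂, h₃]))
  simp only [hrad, mul_comm (2 : ℝ), ← div_div]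
  refine ⟨?_, ?_, ?_⟩
  · exact (t.dist_div_sin_angle_div_two_eq_circumradius (i₁ := 1) (i₂ := 0) (i₃ := 2)
      (by decide) (by decide) (by decide)).symm
  · exact (t.dist_div_sin_angle_div_two_eq_circumradius (i₁ := 0) (i₂ := 1) (i₃ := 2)
      (by decide) (by decide) (by decide)).symm
  · exact (t.dist_div_sin_angle_div_two_eq_circumradius (i₁ := 0) (i₂ := 2) (i₃ := 1)
      (by decide) (by decide) (by decide)).symm
end

section
/- Let v₁, v₂, v₃ ∈ ℝ² be affinely independent points forming an obtuse triangle T with angle-side opposite pairs (α, a), (β, b), (γ, c), where α = ∠v₂v₁v₃, β = ∠v₁v₂v₃, γ = ∠v₁v₃v₂, and a = |v₂ − v₃|, b = |v₁ − v₃|, c = |v₁ − v₂|. Assume a ≤ b < c and γ > π/2. Then d({v₁, v₂, v₃}) = b/(2 cos α). -/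
/-- In the part of a triangle `0, u, w` cut off by the segment from `w` to `t • u`, every point is
within `R` of `0` or of `w`, provided that `t • u` is within `R` of both. -/
theorem norm_le_or_norm_sub_le_of_le_mul {E : Type*} [NormedAddCommGroup E] [NormedSpace ℝ E]
    {u w : E} {t R q r : ℝ} (ht : 0 < t) (hP : ‖t • u‖ ≤ R) (hPw : ‖t • u - w‖ ≤ R)
    (hq : 0 ≤ q) (hr : 0 ≤ r) (hqr : q ≤ t * (1 - r)) :
    ‖q • u + r • w‖ ≤ R ∨ ‖q • u + r • w - w‖ ≤ R := by
  have hR : 0 ≤ R := (norm_nonneg _).trans hP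
  have hw : ‖(2⁻¹ : ℝ) • w‖ ≤ R := by
    have h := norm_sub_le (t • u) (t • u - w)
    rw [sub_sub_cancel] at h
    rw [norm_smul, Real.norm_of_nonneg (by norm_num)]
    linarith
  have key : ∀ (x y : E) (a b : ℝ), 0 ≤ a → 0 ≤ b → a + b ≤ 1 → ‖x‖ ≤ R → ‖y‖ ≤ R →
      ‖a • x + b • y‖ ≤ R := by
    intro x y a b ha hb hab hx hy
    calc ‖a • x + b • y‖ ≤ ‖a • x‖ + ‖b • y‖ := norm_add_le _ _
      _ = a * ‖x‖ + b * ‖y‖ := by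
        rw [norm_smul, norm_smul, Real.norm_of_nonneg ha, Real.norm_of_nonneg hb]
      _ ≤ a * R + b * R := by gcongr
      _ ≤ R := by nlinarith
  have hA : 0 ≤ q / t := by positivity
  have hAr : q / t ≤ 1 - r := by rw [div_le_iff₀ ht]; linarith
  have hAt : q / t * t = q := div_mul_cancel₀ q ht.ne'
  rcases le_total (q / t + 2 * r) 1 with h | h
  · left
    have := key (t • u) ((2⁻¹ : ℝ) • w) (q / t) (2 * r) hA (by linarith) h hP hw
    rw [smul_smul, smul_smul, hAt] at this
    convert this using 3
    ring_nf
  · right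
    have := key (t • u - w) ((2⁻¹ : ℝ) • -w) (q / t) (2 * (1 - r - q / t)) hA (by linarith)
      (by linarith) hPw (by rwa [smul_neg, norm_neg])
    rw [smul_sub, smul_smul, hAt] at this
    convert this using 2
    module

section InnerProduct

open scoped RealInnerProductSpace

variable {E : Type*} [NormedAddCommGroup E] [InnerProductSpace ℝ E]

/-- The point where the perpendicular bisector of `0, w` meets the line through `0, u`. -/
theorem norm_smul_sub_eq_of_bisector {u w : E} {t : ℝ} (ht : 2 * t * ⟪u, w⟫ = ‖w‖ ^ 2) :
    ‖t • u - w‖ = ‖t • u‖ := by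
  rw [← sq_eq_sq₀ (norm_nonneg _) (norm_nonneg _), norm_sub_sq_real, real_inner_smul_left]
  linarith

/-- In a triangle `0, u, w` with an obtuse angle at `w`, every point is within distance
`t * ‖u‖` of a vertex, where `t • u` is equidistant from `0` and `w`, and the side from `0` to `w`
is at least as long as the one from `u` to `w`. -/
theorem exists_vertex_norm_le_of_obtuse {u w : E} (hobt : 0 < ⟪w, u - w⟫)
    (hab : ‖u - w‖ ≤ ‖w‖) {t : ℝ} (ht : 2 * t * ⟪u, w⟫ = ‖w‖ ^ 2)
    {p q r : ℝ} (hp : 0 ≤ p) (hq : 0 ≤ q) (hr : 0 ≤ r) (hpqr : p + q + r = 1) :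
    ‖q • u + r • w‖ ≤ t * ‖u‖ ∨ ‖q • u + r • w - u‖ ≤ t * ‖u‖ ∨
      ‖q • u + r • w - w‖ ≤ t * ‖u‖ := by
  have hw : w ≠ 0 := by rintro rfl; simp at hobt
  have huw : u - w ≠ 0 := by intro h; simp [h] at hobt
  have hw' : 0 < ‖w‖ := norm_pos_iff.2 hw
  have huw' : 0 < ‖u - w‖ := norm_pos_iff.2 huw
  set m := ⟪w, u - w⟫ with hm
  have hk : ⟪u, w⟫ = m + ‖w‖ ^ 2 := by
    rw [hm, inner_sub_right, real_inner_self_eq_norm_sq, real_inner_comm]; ring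
  have hl : ⟪-u, w - u⟫ = m + ‖u - w‖ ^ 2 := by
    rw [hm, ← real_inner_self_eq_norm_sq (u - w), ← inner_add_left, add_sub_cancel,
      ← neg_sub u w, inner_neg_neg]
  rw [hk] at ht
  have hkpos : 0 < m + ‖w‖ ^ 2 := by positivity
  have hlpos : 0 < m + ‖u - w‖ ^ 2 := by positivity
  have ht0 : 0 < t := by
    by_contra! h
    nlinarith [pow_pos hw' 2]
  have ht1 : t < 1 / 2 := by
    by_contra! h
    nlinarith
  obtain ⟨s, hs⟩ : ∃ s : ℝ, 2 * s * (m + ‖u - w‖ ^ 2) = ‖u - w‖ ^ 2 :=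
    ⟨‖u - w‖ ^ 2 / (2 * (m + ‖u - w‖ ^ 2)), by field_simp⟩
  have hs0 : 0 < s := by
    by_contra! h
    nlinarith [pow_pos huw' 2]
  have hst : s ≤ t := by
    have hsq : ‖u - w‖ ^ 2 ≤ ‖w‖ ^ 2 := by gcongr
    have h1 : 2 * t * m = (1 - 2 * t) * ‖w‖ ^ 2 := by linarith
    have h2 : 2 * s * m = (1 - 2 * s) * ‖u - w‖ ^ 2 := by linarith
    by_contra! h
    nlinarith [mul_pos (sub_pos.2 h) hobt, mul_pos (sub_pos.2 h) (pow_pos huw' 2)]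
  have hPn : ‖t • u‖ = t * ‖u‖ := by rw [norm_smul, Real.norm_of_nonneg ht0.le]
  have hPw : ‖t • u - w‖ ≤ t * ‖u‖ :=
    ((norm_smul_sub_eq_of_bisector (by rw [hk]; exact ht)).trans hPn).le
  have hQ : ‖s • -u‖ ≤ t * ‖u‖ := by
    rw [norm_smul, Real.norm_of_nonneg hs0.le, norm_neg]; gcongr
  have hQw : ‖s • -u - (w - u)‖ ≤ t * ‖u‖ := by
    rw [norm_smul_sub_eq_of_bisector (by rw [hl, norm_sub_rev w u]; exact hs)]; exact hQ
  rcases le_total q (t * (1 - r)) with h1 | h1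
  · rcases norm_le_or_norm_sub_le_of_le_mul ht0 hPn.le hPw hq hr h1 with h | h
    · exact Or.inl h
    · exact Or.inr (Or.inr h)
  have hp' : p = 1 - q - r := by linarith
  rcases le_total p (s * (1 - r)) with h2 | h2
  · right
    rcases norm_le_or_norm_sub_le_of_le_mul hs0 hQ hQw hp hr h2 with h | h
    · left
      convert h using 2
      subst hp'; module
    · right
      convert h using 2
      subst hp'; module
  · right; right
    have hd : 0 < 1 - s - t := by linarith
    have hR : 0 ≤ t * ‖u‖ := by positivity
    have hA : 0 ≤ (p - s * (1 - r)) / (1 - s - t) := div_nonneg (by linarith) hd.le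
    have hB : 0 ≤ (q - t * (1 - r)) / (1 - s - t) := div_nonneg (by linarith) hd.le
    set a := (p - s * (1 - r)) / (1 - s - t) with ha
    set b := (q - t * (1 - r)) / (1 - s - t) with hb
    have hab1 : a + b = 1 - r := by rw [ha, hb, hp']; field_simp; ring
    have hab2 : a * t + b * (1 - s) = q := by rw [ha, hb, hp']; field_simp; ring
    have hx : q • u + r • w - w = a • (t • u - w) + b • (s • -u - (w - u)) := by
      rw [← hab2, show r = 1 - a - b by linarith]; module
    rw [hx]
    calc _ ≤ ‖a • (t • u - w)‖ + ‖b • (s • -u - (w - u))‖ := norm_add_le _ _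
      _ = a * ‖t • u - w‖ + b * ‖s • -u - (w - u)‖ := by
        rw [norm_smul, norm_smul, Real.norm_of_nonneg hA, Real.norm_of_nonneg hB]
      _ ≤ a * (t * ‖u‖) + b * (t * ‖u‖) := by gcongr
      _ ≤ t * ‖u‖ := by nlinarith

end InnerProduct

theorem hausdorff_distance_obtuse_triangle (v₁ v₂ v₃ : EuclideanSpace ℝ (Fin 2))
    (hind : AffineIndependent ℝ ![v₁, v₂, v₃])
    (hab : dist v₂ v₃ ≤ dist v₁ v₃) (hbc : dist v₁ v₃ < dist v₁ v₂)
    (hγ : EuclideanGeometry.angle v₁ v₃ v₂ > Real.pi / 2) :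
    hdist {v₁, v₂, v₃} = dist v₁ v₃ / (2 * Real.cos (EuclideanGeometry.angle v₂ v₁ v₃)) := by
  obtain ⟨u, rfl⟩ : ∃ u, v₂ = v₁ + u := ⟨v₂ - v₁, by abel⟩
  obtain ⟨w, rfl⟩ : ∃ w, v₃ = v₁ + w := ⟨v₃ - v₁, by abel⟩
  have hobt : 0 < inner ℝ w (u - w) := by
    by_contra! h
    refine absurd hγ (not_lt.2 ?_)
    rw [EuclideanGeometry.angle, InnerProductGeometry.angle, Real.arccos_le_pi_div_two]
    refine div_nonneg ?_ (by positivity)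
    have : inner ℝ (v₁ -ᵥ (v₁ + w)) (v₁ + u -ᵥ (v₁ + w)) = -(inner ℝ w (u - w)) := by
      rw [← inner_neg_left]; congr 1 <;> simp
    linarith
  have hab' : ‖u - w‖ ≤ ‖w‖ := by
    simpa [dist_eq_norm] using hab
  have hw : 0 < ‖w‖ := norm_pos_iff.2 (by rintro rfl; simp at hobt)
  have hu : 0 < ‖u‖ := by
    have : ‖w‖ < ‖u‖ := by simpa [dist_eq_norm] using hbc
    linarith
  have hk : ‖w‖ ^ 2 < inner ℝ u w := by
    rw [inner_sub_right, real_inner_self_eq_norm_sq, real_inner_comm] at hobt; linarith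
  have hk0 : 0 < inner ℝ u w := by nlinarith
  obtain ⟨t, ht⟩ : ∃ t, t = ‖w‖ ^ 2 / (2 * inner ℝ u w) := ⟨_, rfl⟩
  have ht2 : 2 * t * inner ℝ u w = ‖w‖ ^ 2 := by rw [ht]; field_simp
  have ht0 : 0 < t := by rw [ht]; positivity
  have ht1 : t < 1 / 2 := by
    by_contra! h
    nlinarith
  have hR : dist v₁ (v₁ + w) / (2 * Real.cos (EuclideanGeometry.angle (v₁ + u) v₁ (v₁ + w)))
      = t * ‖u‖ := by
    rw [EuclideanGeometry.angle, InnerProductGeometry.cos_angle, ht]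
    simp only [dist_self_add_right, vsub_eq_sub, add_sub_cancel_left]
    field_simp
  rw [hR, hdist]
  have hPn : ‖t • u‖ = t * ‖u‖ := by rw [norm_smul, Real.norm_of_nonneg ht0.le]
  have hPw : ‖t • u - w‖ = t * ‖u‖ := (norm_smul_sub_eq_of_bisector ht2).trans hPn
  have hfin : ({v₁, v₁ + u, v₁ + w} : Set (EuclideanSpace ℝ (Fin 2))).Finite := by simp
  have hne : ({v₁, v₁ + u, v₁ + w} : Set (EuclideanSpace ℝ (Fin 2))).Nonempty := by simp
  have hsub := subset_convexHull ℝ ({v₁, v₁ + u, v₁ + w} : Set (EuclideanSpace ℝ (Fin 2)))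
  apply le_antisymm
  · refine Metric.hausdorffDist_le_of_mem_dist (by positivity) ?_ ?_
    · intro x hx
      rw [convexHull_insert (by simp), convexHull_pair, mem_convexJoin] at hx
      obtain ⟨y, rfl, z, ⟨c, d, hc, hd, hcd, rfl⟩, e, f, he, hf, hef, rfl⟩ := hx
      have hx : e • y + f • (c • (y + u) + d • (y + w)) = y + ((f * c) • u + (f * d) • w) := by
        rw [show e = 1 - f by linarith, show c = 1 - d by linarith]; module
      rw [hx]
      have hsum : e + f * c + f * d = 1 := by rw [add_assoc, ← mul_add, hcd]; linarith
      rcases exists_vertex_norm_le_of_obtuse hobt hab' ht2 he (mul_nonneg hf hc)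
        (mul_nonneg hf hd) hsum with h | h | h
      · exact ⟨y, by simp, by simpa using h⟩
      · exact ⟨y + u, by simp, by rwa [dist_add_left, dist_eq_norm]⟩
      · exact ⟨y + w, by simp, by rwa [dist_add_left, dist_eq_norm]⟩
    · intro x hx
      exact ⟨x, hsub hx, by rw [dist_self]; positivity⟩
  · have hP : v₁ + t • u ∈ convexHull ℝ {v₁, v₁ + u, v₁ + w} := by
      have := (convex_convexHull ℝ {v₁, v₁ + u, v₁ + w}) (hsub (by simp : v₁ ∈ _))
        (hsub (by simp : v₁ + u ∈ _)) (by linarith : 0 ≤ 1 - t) ht0.le (by ring)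
      convert this using 1
      module
    have hle := Metric.infDist_le_hausdorffDist_of_mem hP
      (Metric.hausdorffEDist_ne_top_of_nonempty_of_bounded ⟨_, hP⟩ hne
        (isBounded_convexHull.2 hfin.isBounded) hfin.isBounded)
    refine le_trans ?_ hle
    rw [Metric.le_infDist hne]
    rintro y (rfl | rfl | rfl)
    · simpa using hPn.ge
    · rw [dist_add_left, dist_eq_norm, show t • u - u = -((1 - t) • u) by module, norm_neg,
        norm_smul, Real.norm_of_nonneg (by linarith)]
      gcongr
      linarith
    · rw [dist_add_left, dist_eq_norm, hPw]
end

section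
/- Let v₁, v₂, v₃ ∈ ℝ² be affinely independent points forming a right triangle, i.e., one of the interior angles equals π/2, and let c be the length of the hypotenuse (the side opposite the right angle). Then d({v₁, v₂, v₃}) = c/2. -/
/-- In a right triangle, the point with barycentric coordinates `a`, `b`, `c` lies within half the
hypotenuse of one of the vertices. -/
theorem exists_dist_le_half_of_inner_eq_zero {E : Type*} [NormedAddCommGroup E]
    [InnerProductSpace ℝ E] {v₁ v₂ v₃ : E} (h : inner ℝ (v₁ - v₃) (v₂ - v₃) = 0) {a b c : ℝ}
    (ha : 0 ≤ a) (hb : 0 ≤ b) (hc : 0 ≤ c) (habc : a + b + c = 1) :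
    ∃ y ∈ ({v₁, v₂, v₃} : Set E), dist (a • v₁ + b • v₂ + c • v₃) y ≤ dist v₁ v₂ / 2 := by
  have pyth : ∀ s t : ℝ, ‖s • (v₁ - v₃) + t • (v₂ - v₃)‖ ^ 2 =
      s ^ 2 * ‖v₁ - v₃‖ ^ 2 + t ^ 2 * ‖v₂ - v₃‖ ^ 2 := by
    intro s t
    rw [norm_add_sq_real, inner_smul_left, inner_smul_right, h, norm_smul, norm_smul, mul_pow,
      mul_pow, Real.norm_eq_abs, Real.norm_eq_abs, sq_abs, sq_abs]
    simp
  have hyp : dist v₁ v₂ ^ 2 = ‖v₁ - v₃‖ ^ 2 + ‖v₂ - v₃‖ ^ 2 := by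
    have := pyth 1 (-1)
    rw [dist_eq_norm, show v₁ - v₂ = (1 : ℝ) • (v₁ - v₃) + (-1 : ℝ) • (v₂ - v₃) by module, this]
    ring
  have key : ∀ (y : E) (s t : ℝ), a • v₁ + b • v₂ + c • v₃ - y = s • (v₁ - v₃) + t • (v₂ - v₃) →
      |s| ≤ 1 / 2 → |t| ≤ 1 / 2 → dist (a • v₁ + b • v₂ + c • v₃) y ≤ dist v₁ v₂ / 2 := by
    intro y s t hy hs ht
    refine le_of_sq_le_sq ?_ (by positivity)
    rw [div_pow, hyp, dist_eq_norm, hy, pyth]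
    have hs' : s ^ 2 ≤ (1 / 2) ^ 2 := sq_le_sq' (abs_le.1 hs).1 (abs_le.1 hs).2
    have ht' : t ^ 2 ≤ (1 / 2) ^ 2 := sq_le_sq' (abs_le.1 ht).1 (abs_le.1 ht).2
    nlinarith [mul_le_mul_of_nonneg_right hs' (sq_nonneg ‖v₁ - v₃‖),
      mul_le_mul_of_nonneg_right ht' (sq_nonneg ‖v₂ - v₃‖)]
  obtain rfl : c = 1 - a - b := by linarith
  rcases le_total a (1 / 2) with ha' | ha'
  · rcases le_total b (1 / 2) with hb' | hb'
    · exact ⟨v₃, by simp, key v₃ a b (by module) (abs_le.2 ⟨by linarith, ha'⟩)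
        (abs_le.2 ⟨by linarith, hb'⟩)⟩
    · exact ⟨v₂, by simp, key v₂ a (b - 1) (by module) (abs_le.2 ⟨by linarith, ha'⟩)
        (abs_le.2 ⟨by linarith, by linarith⟩)⟩
  · exact ⟨v₁, by simp, key v₁ (a - 1) b (by module) (abs_le.2 ⟨by linarith, by linarith⟩)
      (abs_le.2 ⟨by linarith, by linarith⟩)⟩

theorem exists_weights_of_mem_convexHull_triple_s4 {E : Type*} [AddCommGroup E] [Module ℝ E]
    {v₁ v₂ v₃ x : E} (hx : x ∈ convexHull ℝ {v₁, v₂, v₃}) :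
    ∃ a b c : ℝ, 0 ≤ a ∧ 0 ≤ b ∧ 0 ≤ c ∧ a + b + c = 1 ∧ a • v₁ + b • v₂ + c • v₃ = x := by
  rw [convexHull_insert (Set.insert_nonempty _ _), convexHull_pair, mem_convexJoin] at hx
  obtain ⟨_, rfl, y, ⟨s, t, hs, ht, hst, rfl⟩, ⟨a, b, ha, hb, hab, rfl⟩⟩ := hx
  refine ⟨a, b * s, b * t, ha, by positivity, by positivity, ?_, by module⟩
  rw [add_assoc, ← mul_add, hst, mul_one, hab]

/-- The midpoint of the hypotenuse is equidistant from the three vertices. -/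
theorem dist_midpoint_of_inner_eq_zero {E : Type*} [NormedAddCommGroup E]
    [InnerProductSpace ℝ E] {v₁ v₂ v₃ : E} (h : inner ℝ (v₁ - v₃) (v₂ - v₃) = 0) :
    dist (midpoint ℝ v₁ v₂) v₃ = dist v₁ v₂ / 2 := by
  have hsum : ‖(v₁ - v₃) + (v₂ - v₃)‖ = ‖(v₁ - v₃) - (v₂ - v₃)‖ := by
    rw [← sq_eq_sq₀ (norm_nonneg _) (norm_nonneg _), norm_add_sq_real, norm_sub_sq_real (v₁ - v₃), h]
    ring
  rw [dist_eq_norm, dist_eq_norm, midpoint_eq_smul_add, ← sub_sub_sub_cancel_right v₁ v₂ v₃,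
    ← hsum, invOf_eq_inv,
    show (2 : ℝ)⁻¹ • (v₁ + v₂) - v₃ = (2 : ℝ)⁻¹ • ((v₁ - v₃) + (v₂ - v₃)) by module, norm_smul]
  norm_num
  ring

theorem hausdorff_distance_right_triangle (v₁ v₂ v₃ : EuclideanSpace ℝ (Fin 2))
    (hind : AffineIndependent ℝ ![v₁, v₂, v₃])
    (hright : EuclideanGeometry.angle v₁ v₃ v₂ = Real.pi / 2) :
    hdist {v₁, v₂, v₃} = dist v₁ v₂ / 2 := by
  have h : inner ℝ (v₁ - v₃) (v₂ - v₃) = 0 :=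
    InnerProductGeometry.inner_eq_zero_iff_angle_eq_pi_div_two _ _ |>.2 hright
  have hne : ({v₁, v₂, v₃} : Set (EuclideanSpace ℝ (Fin 2))).Nonempty := Set.insert_nonempty _ _
  have hfin : ({v₁, v₂, v₃} : Set (EuclideanSpace ℝ (Fin 2))).Finite := Set.toFinite _
  apply le_antisymm
  · refine Metric.hausdorffDist_le_of_mem_dist (by positivity) (fun x hx => ?_) fun x hx =>
      ⟨x, subset_convexHull ℝ _ hx, by rw [dist_self]; positivity⟩
    obtain ⟨a, b, c, ha, hb, hc, habc, rfl⟩ := exists_weights_of_mem_convexHull_triple_s4 hx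
    exact exists_dist_le_half_of_inner_eq_zero h ha hb hc habc
  · have hmem : midpoint ℝ v₁ v₂ ∈ convexHull ℝ {v₁, v₂, v₃} :=
      (convex_convexHull ℝ _).midpoint_mem (subset_convexHull ℝ _ (by simp))
        (subset_convexHull ℝ _ (by simp))
    refine le_trans ((Metric.le_infDist hne).2 ?_) (Metric.infDist_le_hausdorffDist_of_mem hmem
      (Metric.hausdorffEDist_ne_top_of_nonempty_of_bounded hne.convexHull hne
        (isBounded_convexHull.2 hfin.isBounded) hfin.isBounded))
    rintro y (rfl | rfl | rfl)
    · rw [dist_midpoint_left, Real.norm_two]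
      linarith
    · rw [dist_midpoint_right, Real.norm_two]
      linarith
    · exact (dist_midpoint_of_inner_eq_zero h).ge
end

section
/- Let u, v ∈ ℝ² be linearly independent vectors and p ∈ ℝ². Let P = {p, p+u, p+v, p+u+v} be the vertex set of the parallelogram with side lengths |u| and |v|. Then d(P) ≤ (1/2)·√(|u|² + |v|²); that is, among all parallelograms with the given side lengths, the Hausdorff distance from the vertex set to its convex hull is largest for the rectangle. -/
section Parallelogram

variable {E : Type*} [NormedAddCommGroup E] [InnerProductSpace ℝ E]

/-- Every point of the convex hull of the vertices of a parallelogram is a vertex plus a combination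
of the sides with coefficients in the unit interval. -/
theorem exists_coord_of_mem_convexHull_parallelogram {p u v x : E}
    (hx : x ∈ convexHull ℝ ({p, p + u, p + v, p + u + v} : Set E)) :
    ∃ s ∈ Set.Icc (0 : ℝ) 1, ∃ t ∈ Set.Icc (0 : ℝ) 1, x = p + s • u + t • v := by
  refine convexHull_min (t := {x | ∃ s ∈ Set.Icc (0 : ℝ) 1, ∃ t ∈ Set.Icc (0 : ℝ) 1,
    x = p + s • u + t • v}) ?_ ?_ hx
  · rintro y (rfl | rfl | rfl | rfl)
    · exact ⟨0, by simp, 0, by simp, by simp⟩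
    · exact ⟨1, by simp, 0, by simp, by simp⟩
    · exact ⟨0, by simp, 1, by simp, by simp⟩
    · exact ⟨1, by simp, 1, by simp, by simp⟩
  · rintro _ ⟨s, hs, t, ht, rfl⟩ _ ⟨s', hs', t', ht', rfl⟩ a b ha hb hab
    refine ⟨a * s + b * s', convex_Icc 0 1 hs hs' ha hb hab,
      a * t + b * t', convex_Icc 0 1 ht ht' ha hb hab, ?_⟩
    obtain rfl : b = 1 - a := by linarith
    module

theorem norm_smul_add_smul_sq (s t : ℝ) (u v : E) :
    ‖s • u + t • v‖ ^ 2 = s ^ 2 * ‖u‖ ^ 2 + 2 * (s * t * inner ℝ u v) + t ^ 2 * ‖v‖ ^ 2 := by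
  rw [norm_add_sq_real, real_inner_smul_left, real_inner_smul_right, norm_smul, norm_smul,
    mul_pow, mul_pow, Real.norm_eq_abs, Real.norm_eq_abs, sq_abs, sq_abs]
  ring

/-- Every point of a parallelogram is within half the diagonal of the rectangle with the same side
lengths of some vertex. -/
theorem exists_vertex_dist_le_parallelogram {s t : ℝ} (hs : s ∈ Set.Icc (0 : ℝ) 1)
    (ht : t ∈ Set.Icc (0 : ℝ) 1) (p u v : E) :
    ∃ y ∈ ({p, p + u, p + v, p + u + v} : Set E),
      dist (p + s • u + t • v) y ≤ (1 / 2) * Real.sqrt (‖u‖ ^ 2 + ‖v‖ ^ 2) := by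
  obtain ⟨hs0, hs1⟩ := hs
  obtain ⟨ht0, ht1⟩ := ht
  by_contra! h
  have key (a b : ℝ) (hy : p + a • u + b • v ∈ ({p, p + u, p + v, p + u + v} : Set E)) :
      (‖u‖ ^ 2 + ‖v‖ ^ 2) / 4 < (s - a) ^ 2 * ‖u‖ ^ 2 + 2 * ((s - a) * (t - b) * inner ℝ u v)
        + (t - b) ^ 2 * ‖v‖ ^ 2 := by
    have h1 := pow_lt_pow_left₀ (h _ hy) (by positivity) two_ne_zero
    rw [mul_pow, Real.sq_sqrt (by positivity), dist_eq_norm,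
      show p + s • u + t • v - (p + a • u + b • v) = (s - a) • u + (t - b) • v by module,
      norm_smul_add_smul_sq] at h1
    linarith
  have h00 := key 0 0 (by simp)
  have h10 := key 1 0 (by simp)
  have h01 := key 0 1 (by simp)
  have h11 := key 1 1 (by simp)
  simp only [sub_zero] at h00 h10 h01
  have average {r x y a : ℝ} (ha0 : 0 ≤ a) (ha1 : a ≤ 1) (hx : r < x) (hy : r < y) :
      r < (1 - a) * x + a * y := by
    rcases ha0.eq_or_lt with rfl | ha
    · linarith
    · nlinarith [mul_pos ha (sub_pos.2 hy), mul_nonneg (sub_nonneg.2 ha1) (sub_pos.2 hx).le]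
  -- The weighted average of the squared distances is `s (1 - s) ‖u‖² + t (1 - t) ‖v‖²`.
  have h := average ht0 ht1 (average hs0 hs1 h00 h10) (average hs0 hs1 h01 h11)
  nlinarith [mul_nonneg (sq_nonneg (2 * s - 1)) (sq_nonneg ‖u‖),
    mul_nonneg (sq_nonneg (2 * t - 1)) (sq_nonneg ‖v‖)]

end Parallelogram

theorem hausdorff_distance_parallelogram (u v p : EuclideanSpace ℝ (Fin 2))
    (hind : LinearIndependent ℝ ![u, v]) :
    hdist {p, p + u, p + v, p + u + v} ≤ (1 / 2) * Real.sqrt (‖u‖ ^ 2 + ‖v‖ ^ 2) := by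
  refine Metric.hausdorffDist_le_of_mem_dist (by positivity) (fun x hx => ?_)
    fun x hx => ⟨x, subset_convexHull ℝ _ hx, by rw [dist_self]; positivity⟩
  obtain ⟨s, hs, t, ht, rfl⟩ := exists_coord_of_mem_convexHull_parallelogram hx
  exact exists_vertex_dist_le_parallelogram hs ht p u v
end

section
/- Let A and B be nonempty compact sets in ℝⁿ with B convex. Then d(A+B) ≤ d(A). -/
open Pointwise

theorem hdist_add_convex_le {n : ℕ} (A B : Set (EuclideanSpace ℝ (Fin n)))
    (hA : A.Nonempty) (hB : B.Nonempty) (hAc : IsCompact A) (hBc : IsCompact B)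
    (hBconv : Convex ℝ B) :
    hdist (A + B) ≤ hdist A := by
  have hfin : Metric.hausdorffEDist (convexHull ℝ A) A ≠ ⊤ :=
    Metric.hausdorffEDist_ne_top_of_nonempty_of_bounded hA.convexHull hA
      (isBounded_convexHull.mpr hAc.isBounded) hAc.isBounded
  refine Metric.hausdorffDist_le_of_mem_dist Metric.hausdorffDist_nonneg ?_ ?_
  · intro x hx
    rw [convexHull_add, hBconv.convexHull_eq] at hx
    obtain ⟨a, ha, b, hb, rfl⟩ := Set.mem_add.mp hx
    obtain ⟨c, hc, hac⟩ := hAc.exists_infDist_eq_dist hA a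
    refine ⟨c + b, Set.add_mem_add hc hb, ?_⟩
    rw [dist_add_right, ← hac]
    exact Metric.infDist_le_hausdorffDist_of_mem ha hfin
  · intro x hx
    exact ⟨x, subset_convexHull ℝ _ hx, (dist_self x).trans_le Metric.hausdorffDist_nonneg⟩
end

section
/- Let n ≥ 2 and let A and B be nonempty compact sets in ℝⁿ such that the affine span of A has dimension 1 (i.e., A is contained in a line but is not a single point). Then d(A+B)² ≤ d(A)² + d(B)². -/
open Pointwise

/-- A compact collinear set is contained in a segment whose endpoints belong to the set. -/
theorem Collinear.exists_subset_segment {E : Type*} [NormedAddCommGroup E]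
    [InnerProductSpace ℝ E] {A : Set E} (hcol : Collinear ℝ A) (hA : A.Nonempty)
    (hAc : IsCompact A) : ∃ a₁ ∈ A, ∃ a₂ ∈ A, A ⊆ segment ℝ a₁ a₂ := by
  obtain ⟨p, v, hv⟩ := (collinear_iff_exists_forall_eq_smul_vadd A).1 hcol
  have hcont : ContinuousOn (fun a : E => inner ℝ v a) A := by fun_prop
  obtain ⟨a₁, ha₁, hmin⟩ := hAc.exists_isMinOn hA hcont
  obtain ⟨a₂, ha₂, hmax⟩ := hAc.exists_isMaxOn hA hcont
  refine ⟨a₁, ha₁, a₂, ha₂, fun a ha => ?_⟩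
  have h₁ : inner ℝ v a₁ ≤ inner ℝ v a := hmin ha
  have h₂ : inner ℝ v a ≤ inner ℝ v a₂ := hmax ha
  obtain ⟨r, rfl⟩ := hv a ha
  obtain ⟨r₁, rfl⟩ := hv a₁ ha₁
  obtain ⟨r₂, rfl⟩ := hv a₂ ha₂
  by_cases hv0 : v = 0
  · simp [hv0]
  have hpos : 0 < inner ℝ v v := real_inner_self_pos.2 hv0
  simp only [vadd_eq_add, inner_add_right, inner_smul_right, add_le_add_iff_right,
    mul_le_mul_iff_left₀ hpos] at h₁ h₂
  have hr : r ∈ segment ℝ r₁ r₂ := by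
    rw [segment_eq_Icc (h₁.trans h₂)]
    exact ⟨h₁, h₂⟩
  obtain ⟨s, t, hs, ht, hst, rfl⟩ := hr
  refine ⟨s, t, hs, ht, hst, ?_⟩
  obtain rfl : s = 1 - t := by linarith
  simp only [vadd_eq_add, smul_eq_mul]
  module

/-- Each point of the convex hull of a compact set lies within `hdist` of the set. -/
theorem exists_dist_le_hdist {n : ℕ} {A : Set (EuclideanSpace ℝ (Fin n))} (hA : A.Nonempty)
    (hAc : IsCompact A) {q : EuclideanSpace ℝ (Fin n)} (hq : q ∈ convexHull ℝ A) :
    ∃ x ∈ A, dist q x ≤ hdist A := by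
  obtain ⟨x, hx, hqx⟩ := hAc.exists_infDist_eq_dist hA q
  refine ⟨x, hx, hqx ▸ Metric.infDist_le_hausdorffDist_of_mem hq ?_⟩
  exact Metric.hausdorffEDist_ne_top_of_nonempty_of_bounded hA.convexHull hA
    (isBounded_convexHull.2 hAc.isBounded) hAc.isBounded

/-- If every point of the convex hull lies within `r` of the set, then `hdist` is at most `r`. -/
theorem hdist_le_of_forall_exists_dist_le {n : ℕ} {A : Set (EuclideanSpace ℝ (Fin n))} {r : ℝ}
    (hr : 0 ≤ r) (h : ∀ q ∈ convexHull ℝ A, ∃ x ∈ A, dist q x ≤ r) : hdist A ≤ r :=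
  Metric.hausdorffDist_le_of_mem_dist hr h fun x hx =>
    ⟨x, subset_convexHull ℝ A hx, by simpa using hr⟩

/-- The Pythagorean theorem for a multiple of `w` minus a vector orthogonal to `w`. -/
theorem norm_smul_sub_sq_of_inner_eq_zero {E : Type*} [NormedAddCommGroup E]
    [InnerProductSpace ℝ E] {w y : E} (h : inner ℝ w y = 0) (c : ℝ) :
    ‖c • w - y‖ ^ 2 = c ^ 2 * ‖w‖ ^ 2 + ‖y‖ ^ 2 := by
  rw [norm_sub_sq_real, inner_smul_left, h, norm_smul, mul_pow, Real.norm_eq_abs, sq_abs]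
  simp

/-- Pythagorean bound for `hdist` of a Minkowski sum with a collinear summand. -/
theorem hdist_add_sq_le_of_collinear {n : ℕ} {A B : Set (EuclideanSpace ℝ (Fin n))}
    (hA : A.Nonempty) (hB : B.Nonempty) (hAc : IsCompact A) (hBc : IsCompact B)
    (hcol : Collinear ℝ A) : hdist (A + B) ^ 2 ≤ hdist A ^ 2 + hdist B ^ 2 := by
  obtain ⟨a₁, ha₁, a₂, ha₂, hseg⟩ := hcol.exists_subset_segment hA hAc
  have hsub : segment ℝ a₁ a₂ ⊆ convexHull ℝ A := segment_subset_convexHull ha₁ ha₂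
  have hull : convexHull ℝ A ⊆ segment ℝ a₁ a₂ := convexHull_min hseg (convex_segment a₁ a₂)
  rw [segment_eq_image'] at hseg hsub hull
  have hnn : 0 ≤ hdist (A + B) := Metric.hausdorffDist_nonneg
  rw [← Real.le_sqrt hnn (by positivity)]
  refine hdist_le_of_forall_exists_dist_le (Real.sqrt_nonneg _) fun q hq => ?_
  rw [convexHull_add] at hq
  obtain ⟨a, ha, b, hb, rfl⟩ := hq
  obtain ⟨θ, ⟨hθ0, hθ1⟩, rfl⟩ := hull ha
  obtain ⟨x, hx, hbx⟩ := exists_dist_le_hdist hB hBc hb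
  set w := a₂ - a₁ with hw
  obtain ⟨u, y, hxb, hy⟩ : ∃ (u : ℝ) (y : EuclideanSpace ℝ (Fin n)),
      x = b + (u • w + y) ∧ inner ℝ w y = 0 := by
    refine ⟨inner ℝ w (x - b) / inner ℝ w w, x - b - (inner ℝ w (x - b) / inner ℝ w w) • w,
      by abel, ?_⟩
    by_cases hw0 : w = 0
    · simp [hw0]
    · rw [inner_sub_right _ (x - b), inner_smul_right,
        div_mul_cancel₀ _ (inner_self_ne_zero.2 hw0), sub_self]
  have hB2 : u ^ 2 * ‖w‖ ^ 2 + ‖y‖ ^ 2 ≤ hdist B ^ 2 := by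
    have hsq := pow_le_pow_left₀ dist_nonneg hbx 2
    rw [dist_eq_norm, hxb, show b - (b + (u • w + y)) = (-u) • w - y by module,
      norm_smul_sub_sq_of_inner_eq_zero hy, neg_sq] at hsq
    exact hsq
  suffices h : ∃ a' ∈ A, ∃ c : ℝ, a₁ + (θ - u) • w = a' + c • w ∧
      c ^ 2 * ‖w‖ ^ 2 + ‖y‖ ^ 2 ≤ hdist A ^ 2 + hdist B ^ 2 by
    obtain ⟨a', ha', c, hc, hle⟩ := h
    refine ⟨a' + x, Set.add_mem_add ha' hx, Real.le_sqrt_of_sq_le ?_⟩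
    rw [dist_eq_norm]
    have : a₁ + θ • w + b - (a' + x) = c • w - y := by
      rw [hxb, eq_sub_of_add_eq' hc.symm]
      module
    simpa only [this, norm_smul_sub_sq_of_inner_eq_zero hy] using hle
  rcases lt_or_ge (θ - u) 0 with hneg | hnonneg
  · refine ⟨a₁, ha₁, θ - u, rfl, ?_⟩
    have : (θ - u) ^ 2 * ‖w‖ ^ 2 ≤ u ^ 2 * ‖w‖ ^ 2 := by
      gcongr ?_ * _
      nlinarith
    nlinarith [sq_nonneg (hdist A)]
  rcases lt_or_ge 1 (θ - u) with hgt | hle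
  · refine ⟨a₂, ha₂, θ - u - 1, by rw [hw]; module, ?_⟩
    have : (θ - u - 1) ^ 2 * ‖w‖ ^ 2 ≤ u ^ 2 * ‖w‖ ^ 2 := by
      gcongr ?_ * _
      nlinarith
    nlinarith [sq_nonneg (hdist A)]
  · obtain ⟨a', ha', hdist'⟩ := exists_dist_le_hdist hA hAc (hsub ⟨θ - u, ⟨hnonneg, hle⟩, rfl⟩)
    obtain ⟨φ, -, rfl⟩ := hseg ha'
    refine ⟨_, ha', θ - u - φ, by module, ?_⟩
    have hsq := pow_le_pow_left₀ dist_nonneg hdist' 2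
    simp only at hsq
    rw [dist_eq_norm, show a₁ + (θ - u) • w - (a₁ + φ • w) = (θ - u - φ) • w by module,
      norm_smul, mul_pow, Real.norm_eq_abs, sq_abs] at hsq
    nlinarith [mul_nonneg (sq_nonneg u) (sq_nonneg ‖w‖)]

theorem dyn_farkhi_one_dimensional {n : ℕ} (hn : 2 ≤ n)
    (A B : Set (EuclideanSpace ℝ (Fin n)))
    (hA : A.Nonempty) (hB : B.Nonempty) (hAc : IsCompact A) (hBc : IsCompact B)
    (hdimA : Module.finrank ℝ (affineSpan ℝ A).direction = 1) :
    hdist (A + B) ^ 2 ≤ hdist A ^ 2 + hdist B ^ 2 := by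
  refine hdist_add_sq_le_of_collinear hA hB hAc hBc (collinear_iff_finrank_le_one.2 ?_)
  rw [← direction_affineSpan, hdimA]
end

section
/- Let A and B be nonempty compact sets in ℝ² with 0 ∈ B. Then conv(A+B) = conv(A) ∪ (∂conv(A) + conv(B)), where ∂conv(A) denotes the topological frontier of conv(A) in ℝ² and the sum is the Minkowski sum. -/
open Pointwise

theorem IsPreconnected.inter_frontier_nonempty_of_mem_of_notMem {X : Type*} [TopologicalSpace X]
    {s t : Set X} (hs : IsPreconnected s) (hst : (s ∩ t).Nonempty) (hst' : (s ∩ tᶜ).Nonempty) :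
    (s ∩ frontier t).Nonempty := by
  by_contra h
  rw [Set.not_nonempty_iff_eq_empty] at h
  have hdisj : ∀ x ∈ s, x ∉ frontier t := fun x hx hxt => (h ▸ ⟨hx, hxt⟩ : x ∈ (∅ : Set X))
  obtain ⟨x, hx, hxt⟩ := hst
  obtain ⟨y, hy, hyt⟩ := hst'
  obtain ⟨z, -, hz, hz'⟩ := hs (interior t) (closure t)ᶜ isOpen_interior isClosed_closure.isOpen_compl
    (fun z hz => by
      by_cases hzt : z ∈ interior t
      · exact Or.inl hzt
      · exact Or.inr fun hzc => hdisj z hz ⟨hzc, hzt⟩)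
    ⟨x, hx, by_contra fun hxi => hdisj x hx ⟨subset_closure hxt, hxi⟩⟩
    ⟨y, hy, fun hyc => hdisj y hy ⟨hyc, fun hyi => hyt (interior_subset hyi)⟩⟩
  exact hz' (subset_closure (interior_subset hz))

theorem IsCompact.isCompact_convexHull_of_finiteDimensional {E : Type*} [AddCommGroup E]
    [Module ℝ E] [TopologicalSpace E] [IsTopologicalAddGroup E] [ContinuousSMul ℝ E]
    [FiniteDimensional ℝ E] {s : Set E} (hs : IsCompact s) : IsCompact (convexHull ℝ s) := by
  have key : convexHull ℝ s = ⋃ k ∈ Set.Iic (Module.finrank ℝ E + 1),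
      (fun p : (Fin k → ℝ) × (Fin k → E) => ∑ i, p.1 i • p.2 i) ''
        (stdSimplex ℝ (Fin k) ×ˢ Set.univ.pi fun _ => s) := by
    apply Set.Subset.antisymm
    · intro x hx
      obtain ⟨ι, _, z, w, hz, hind, hw, hw1, rfl⟩ := eq_pos_convex_span_of_mem_convexHull hx
      let e := Fintype.equivFin ι
      refine Set.mem_biUnion (x := Fintype.card ι)
        (hind.card_le_finrank_succ.trans (Nat.succ_le_succ (Submodule.finrank_le _)))
        ⟨(w ∘ e.symm, z ∘ e.symm), ⟨⟨fun i => (hw _).le, ?_⟩, fun i _ => hz ⟨_, rfl⟩⟩, ?_⟩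
      · exact (Equiv.sum_comp e.symm w).trans hw1
      · exact Equiv.sum_comp e.symm fun i => w i • z i
    · refine Set.iUnion₂_subset ?_
      rintro k - _ ⟨⟨w, z⟩, ⟨hw, hz⟩, rfl⟩
      exact (convex_convexHull ℝ s).sum_mem (fun i _ => hw.1 i) hw.2
        fun i hi => subset_convexHull ℝ s (hz i (Set.mem_univ i))
  rw [key]
  exact (Set.finite_Iic _).isCompact_biUnion fun k _ =>
    ((isCompact_stdSimplex ℝ (Fin k)).prod (isCompact_univ_pi fun _ => hs)).image (by fun_prop)

theorem Convex.add_subset_union_frontier_add {E : Type*} [AddCommGroup E] [Module ℝ E]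
    [TopologicalSpace E] [IsTopologicalAddGroup E] [ContinuousSMul ℝ E] {K L : Set E}
    (hL : Convex ℝ L) (h0 : (0 : E) ∈ L) : K + L ⊆ K ∪ (frontier K + L) := by
  rintro _ ⟨a, ha, b, hb, rfl⟩
  by_cases hx : a + b ∈ K
  · exact Or.inl hx
  obtain ⟨y, hy, hyf⟩ : (segment ℝ a (a + b) ∩ frontier K).Nonempty :=
    (convex_segment a (a + b)).isPreconnected.inter_frontier_nonempty_of_mem_of_notMem
      ⟨a, left_mem_segment ℝ _ _, ha⟩ ⟨a + b, right_mem_segment ℝ _ _, hx⟩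
  rw [segment_eq_image'] at hy
  obtain ⟨t, ⟨ht0, ht1⟩, rfl⟩ := hy
  refine Or.inr ⟨_, hyf, (1 - t) • b,
    hL.smul_mem_of_zero_mem h0 hb ⟨by linarith, by linarith⟩, ?_⟩
  simp only [add_sub_cancel_left]
  module

theorem convexHull_sumset_boundary_repr (A B : Set (EuclideanSpace ℝ (Fin 2)))
    (hA : A.Nonempty) (hB : B.Nonempty) (hAc : IsCompact A) (hBc : IsCompact B)
    (h0B : (0 : EuclideanSpace ℝ (Fin 2)) ∈ B) :
    convexHull ℝ (A + B) =
      convexHull ℝ A ∪ (frontier (convexHull ℝ A) + convexHull ℝ B) := by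
  have h0 := subset_convexHull ℝ B h0B
  rw [convexHull_add]
  refine (Convex.add_subset_union_frontier_add (convex_convexHull ℝ B) h0).antisymm
    (Set.union_subset (fun x hx => ⟨x, hx, 0, h0, add_zero x⟩) ?_)
  exact Set.add_subset_add_right hAc.isCompact_convexHull_of_finiteDimensional.isClosed.frontier_subset
end

section
/- Let B be a nonempty compact set in ℝ², let f : ℝ² → ℝ be a nonzero linear functional, and let c ∈ ℝ. Suppose the line L = {y ∈ ℝ² : f(y) = c} intersects conv(B). Then there exist b₁, b₂ ∈ B with f(b₁) ≥ c, f(b₂) ≤ c, and |b₁ − b₂| ≤ 2·d(B). -/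
/-- If a bounded set is covered by two nonempty compact subsets, then these contain points at
distance at most twice the Hausdorff distance from the set to its convex hull. -/
theorem exists_dist_le_two_mul_hausdorffDist_convexHull {E : Type*} [NormedAddCommGroup E]
    [NormedSpace ℝ E] {A P Q : Set E} (hA : Bornology.IsBounded A) (hP : IsCompact P)
    (hQ : IsCompact Q) (hPA : P ⊆ A) (hQA : Q ⊆ A) (hcover : A ⊆ P ∪ Q)
    (hPne : P.Nonempty) (hQne : Q.Nonempty) :
    ∃ p ∈ P, ∃ q ∈ Q, dist p q ≤ 2 * Metric.hausdorffDist (convexHull ℝ A) A := by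
  set r := Metric.hausdorffDist (convexHull ℝ A) A
  have hr : 0 ≤ r := Metric.hausdorffDist_nonneg
  have hAne : A.Nonempty := hPne.mono hPA
  have hfin : Metric.hausdorffEDist (convexHull ℝ A) A ≠ ⊤ :=
    Metric.hausdorffEDist_ne_top_of_nonempty_of_bounded (hAne.mono (subset_convexHull ℝ A)) hAne
      (isBounded_convexHull.2 hA) hA
  have hclosed (S : Set E) : IsClosed {x | Metric.infDist x S ≤ r} :=
    isClosed_le (Metric.continuous_infDist_pt S) continuous_const
  have hmem {S : Set E} {x : E} (hx : x ∈ S) : Metric.infDist x S ≤ r := by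
    rwa [Metric.infDist_zero_of_mem hx]
  have hAPQ : A = P ∪ Q := hcover.antisymm (Set.union_subset hPA hQA)
  have hAc : IsCompact A := hAPQ ▸ hP.union hQ
  obtain ⟨x, -, hxP, hxQ⟩ := isPreconnected_closed_iff.1 (convex_convexHull ℝ A).isPreconnected
    {x | Metric.infDist x P ≤ r} {x | Metric.infDist x Q ≤ r} (hclosed P) (hclosed Q)
    (by
      intro x hx
      obtain ⟨a, ha, hxa⟩ := hAc.exists_infDist_eq_dist hAne x
      have hle : dist x a ≤ r := hxa ▸ Metric.infDist_le_hausdorffDist_of_mem hx hfin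
      exact (hcover ha).imp (fun h => (Metric.infDist_le_dist_of_mem h).trans hle)
        (fun h => (Metric.infDist_le_dist_of_mem h).trans hle))
    (hPne.imp fun p hp => ⟨subset_convexHull ℝ A (hPA hp), hmem hp⟩)
    (hQne.imp fun q hq => ⟨subset_convexHull ℝ A (hQA hq), hmem hq⟩)
  obtain ⟨p, hp, hxp⟩ := hP.exists_infDist_eq_dist hPne x
  obtain ⟨q, hq, hxq⟩ := hQ.exists_infDist_eq_dist hQne x
  refine ⟨p, hp, q, hq, ?_⟩
  have htri := dist_triangle_left p q x
  rw [Set.mem_ofPred_eq] at hxP hxQ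
  linarith

theorem line_through_convexHull_close_points
    (B : Set (EuclideanSpace ℝ (Fin 2)))
    (hB : B.Nonempty) (hBc : IsCompact B)
    (f : EuclideanSpace ℝ (Fin 2) →ₗ[ℝ] ℝ) (hf : f ≠ 0) (c : ℝ)
    (hline : ∃ y ∈ convexHull ℝ B, f y = c) :
    ∃ b₁ ∈ B, ∃ b₂ ∈ B, c ≤ f b₁ ∧ f b₂ ≤ c ∧ dist b₁ b₂ ≤ 2 * hdist B := by
  obtain ⟨y, hy, hyc⟩ := hline
  have hfc : Continuous f := f.continuous_of_finiteDimensional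
  have hupper : (B ∩ {x | c ≤ f x}).Nonempty := by
    by_contra! h
    have hsub : B ⊆ {x | f x < c} := fun b hb => by
      by_contra hcb
      rw [Set.mem_ofPred_eq, not_lt] at hcb
      exact h.subset ⟨hb, hcb⟩
    exact (convexHull_min hsub (convex_halfSpace_lt f.isLinear c) hy).ne hyc
  have hlower : (B ∩ {x | f x ≤ c}).Nonempty := by
    by_contra! h
    have hsub : B ⊆ {x | c < f x} := fun b hb => by
      by_contra hcb
      rw [Set.mem_ofPred_eq, not_lt] at hcb
      exact h.subset ⟨hb, hcb⟩
    exact (convexHull_min hsub (convex_halfSpace_gt f.isLinear c) hy).ne' hyc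
  obtain ⟨b₁, ⟨hb₁, hcb₁⟩, b₂, ⟨hb₂, hcb₂⟩, hdist_le⟩ :=
    exists_dist_le_two_mul_hausdorffDist_convexHull hBc.isBounded
      (hBc.inter_right (isClosed_le continuous_const hfc))
      (hBc.inter_right (isClosed_le hfc continuous_const))
      Set.inter_subset_left Set.inter_subset_left
      (fun b hb => (le_total c (f b)).imp (⟨hb, ·⟩) (⟨hb, ·⟩)) hupper hlower
  exact ⟨b₁, hb₁, b₂, hb₂, hcb₁, hcb₂, hdist_le⟩
end

section
/- Let A and B be nonempty compact sets in ℝⁿ. Then d(A+B)² ≤ rad(A)² + rad(B)², where rad(A) := inf_{x ∈ ℝⁿ} sup_{a ∈ A} |x − a| is the radius of the smallest ball containing A. -/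
open Pointwise

/-- The radius of the smallest ball containing `A`. -/
noncomputable def rad {n : ℕ} (A : Set (EuclideanSpace ℝ (Fin n))) : ℝ :=
  ⨅ x : EuclideanSpace ℝ (Fin n), ⨆ a ∈ A, dist x a

open scoped RealInnerProductSpace in
/-- A point `y` of the convex hull of a subset of a ball of radius `r`, displaced by `v`, has a
point of the set within squared distance `r ^ 2 + ‖v‖ ^ 2`. -/
lemma exists_norm_sub_add_sq_le_of_mem_convexHull {E : Type*} [NormedAddCommGroup E]
    [InnerProductSpace ℝ E] {A : Set E} {c y : E} {r : ℝ} (hr : ∀ a ∈ A, dist c a ≤ r)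
    (hy : y ∈ convexHull ℝ A) (v : E) :
    ∃ a ∈ A, ‖y - a + v‖ ^ 2 ≤ r ^ 2 + ‖v‖ ^ 2 := by
  by_contra! h
  have key (p : E) : ‖y - p + v‖ ^ 2 - ‖c - p‖ ^ 2 =
      ‖y + v‖ ^ 2 - ‖c‖ ^ 2 - 2 * ⟪y + v - c, p⟫ := by
    rw [show y - p + v = (y + v) - p by abel, norm_sub_sq_real, norm_sub_sq_real, inner_sub_left]
    ring
  have hconv : Convex ℝ {p : E | ⟪y + v - c, p⟫ < (‖y + v‖ ^ 2 - ‖c‖ ^ 2 - ‖v‖ ^ 2) / 2} :=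
    convex_halfSpace_lt (innerₛₗ ℝ (y + v - c)).isLinear _
  have hsub : A ⊆ {p : E | ⟪y + v - c, p⟫ < (‖y + v‖ ^ 2 - ‖c‖ ^ 2 - ‖v‖ ^ 2) / 2} := by
    intro a ha
    have h1 : ‖c - a‖ ^ 2 ≤ r ^ 2 := by
      rw [← dist_eq_norm]
      exact pow_le_pow_left₀ dist_nonneg (hr a ha) 2
    have h2 := h a ha
    have h3 := key a
    simp only [Set.mem_ofPred_eq]
    linarith
  have hy' := convexHull_min hsub hconv hy
  have h3 := key y
  simp only [Set.mem_ofPred_eq] at hy'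
  rw [sub_self, zero_add] at h3
  linarith [sq_nonneg ‖c - y‖]

lemma dist_le_biSup_of_isCompact {X : Type*} [PseudoMetricSpace X] {A : Set X}
    (hA : IsCompact A) (c : X) {a : X} (ha : a ∈ A) : dist c a ≤ ⨆ b ∈ A, dist c b := by
  obtain ⟨M, hM⟩ := hA.isBounded.subset_closedBall c
  have hbdd : BddAbove (Set.range fun b => ⨆ _ : b ∈ A, dist c b) := by
    refine ⟨max M 0, ?_⟩
    rintro _ ⟨b, rfl⟩
    refine Real.iSup_le (fun hb => ?_) (le_max_right _ _)
    rw [dist_comm]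
    exact (hM hb).trans (le_max_left _ _)
  refine le_trans ?_ (le_ciSup hbdd a)
  simp [ha]

lemma sq_le_iInf_sq_add_of_forall {ι : Type*} [Nonempty ι] {f : ι → ℝ} (hf : ∀ i, 0 ≤ f i)
    {s t : ℝ} (h : ∀ i, s ≤ f i ^ 2 + t) : s ≤ (⨅ i, f i) ^ 2 + t := by
  have h1 : √(s - t) ≤ ⨅ i, f i :=
    le_ciInf fun i => Real.sqrt_le_iff.2 ⟨hf i, by linarith [h i]⟩
  linarith [(Real.sqrt_le_iff.1 h1).2]

theorem starr_theorem {n : ℕ} (A B : Set (EuclideanSpace ℝ (Fin n)))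
    (hA : A.Nonempty) (hB : B.Nonempty) (hAc : IsCompact A) (hBc : IsCompact B) :
    hdist (A + B) ^ 2 ≤ rad A ^ 2 + rad B ^ 2 := by
  have hnonneg (S : Set (EuclideanSpace ℝ (Fin n))) (c : EuclideanSpace ℝ (Fin n)) :
      0 ≤ ⨆ a ∈ S, dist c a :=
    Real.iSup_nonneg fun _ => Real.iSup_nonneg fun _ => dist_nonneg
  refine sq_le_iInf_sq_add_of_forall (hnonneg A) fun c => ?_
  rw [add_comm (_ ^ 2)]
  refine sq_le_iInf_sq_add_of_forall (hnonneg B) fun c' => ?_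
  refine (Real.le_sqrt Metric.hausdorffDist_nonneg (by positivity)).1 ?_
  refine Metric.hausdorffDist_le_of_mem_dist (Real.sqrt_nonneg _) ?_ fun x hx =>
    ⟨x, subset_convexHull ℝ _ hx, by simp⟩
  intro x hx
  rw [convexHull_add] at hx
  obtain ⟨y, hy, z, hz, rfl⟩ := Set.mem_add.1 hx
  obtain ⟨a, ha, hya⟩ := exists_norm_sub_add_sq_le_of_mem_convexHull
    (fun _ => dist_le_biSup_of_isCompact hAc c) hy 0
  obtain ⟨b, hb, hzb⟩ := exists_norm_sub_add_sq_le_of_mem_convexHull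
    (fun _ => dist_le_biSup_of_isCompact hBc c') hz (y - a)
  refine ⟨a + b, Set.add_mem_add ha hb, Real.le_sqrt_of_sq_le ?_⟩
  rw [dist_eq_norm, show y + z - (a + b) = z - b + (y - a) by abel]
  simp only [add_zero, norm_zero] at hya
  linarith
end
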